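/- Let α > 1/3 and let f : ℝ → ℝ be nonnegative, Lipschitz continuous and of bounded variation. Then on every connected component I of the open set E_α = {x ∈ ℝ : M^α f(x) > f(x)}, the maximal function M^α f is either monotone or V-shaped, i.e. there exists c ∈ I such that M^α f is non-increasing on (l(I), c) and non-decreasing on (c, r(I)), where l(I), r(I) are the endpoints of I. -/

import Mathlib

open MeasureTheory Set Filter Topology NNReal ENNReal

/-- The average of `|f|` over the interval `[y - t, y + t]`. -/
noncomputable def avgAbs (f : ℝ → ℝ) (y t : ℝ) : ℝ :=
  (1 / (2 * t)) * ∫ s in (y - t)..(y + t), |f s|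

/-- The nontangential Hardy–Littlewood maximal function. -/
noncomputable def ntMax (α : ℝ) (f : ℝ → ℝ) (x : ℝ) : ℝ :=
  sSup {r : ℝ | ∃ y t : ℝ, 0 < t ∧ |x - y| ≤ α * t ∧ r = avgAbs f y t}

/-- A continuous function on an order-connected set of reals which satisfies the quasiconvexity
inequality is monotone, antitone or V-shaped. -/
theorem monotoneOn_or_antitoneOn_or_vShaped {g : ℝ → ℝ} {I : Set ℝ} (hI : I.OrdConnected)
    (hg : ContinuousOn g I)
    (hq : ∀ a ∈ I, ∀ c ∈ I, ∀ b, a < b → b < c → g b ≤ max (g a) (g c)) :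
    (MonotoneOn g I ∨ AntitoneOn g I) ∨
      ∃ c ∈ I, AntitoneOn g (I ∩ Iic c) ∧ MonotoneOn g (I ∩ Ici c) := by
  by_cases hm : MonotoneOn g I
  · exact Or.inl (Or.inl hm)
  by_cases ha : AntitoneOn g I
  · exact Or.inl (Or.inr ha)
  right
  simp only [MonotoneOn, AntitoneOn, not_forall, not_le] at hm ha
  obtain ⟨a, haI, b, hbI, hab, hgab⟩ := hm
  obtain ⟨c, hcI, d, hdI, hcd, hgcd⟩ := ha
  have hab' : a < b := lt_of_le_of_ne hab (by rintro rfl; exact lt_irrefl _ hgab)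
  have hcd' : c < d := lt_of_le_of_ne hcd (by rintro rfl; exact lt_irrefl _ hgcd)
  have hpI : min a c ∈ I := by rcases min_choice a c with h | h <;> rw [h] <;> assumption
  have hqI : max b d ∈ I := by rcases max_choice b d with h | h <;> rw [h] <;> assumption
  have hsub : Icc (min a c) (max b d) ⊆ I := hI.out hpI hqI
  have h1 := min_le_left a c
  have h2 := min_le_right a c
  have h3 := le_max_left b d
  have h4 := le_max_right b d
  obtain ⟨e, he, hmin⟩ := isCompact_Icc.exists_isMinOn
    (nonempty_Icc.2 (by linarith : min a c ≤ max b d)) (hg.mono hsub)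
  have hmin' : ∀ w ∈ I, g e ≤ g w := by
    intro w hw
    by_contra! hlt
    rcases lt_or_ge w (min a c) with hwl | hwl
    · have := hq w hw b hbI a (by linarith) hab'
      have hb : g e ≤ g b := hmin ⟨by linarith, h3⟩
      rcases le_max_iff.1 this with h | h <;> linarith
    · rcases lt_or_ge (max b d) w with hwr | hwr
      · have := hq c hcI w hw d hcd' (by linarith)
        have hb : g e ≤ g c := hmin ⟨h2, by linarith⟩
        rcases le_max_iff.1 this with h | h <;> linarith
      · exact absurd (hmin ⟨hwl, hwr⟩ : g e ≤ g w) (not_le.2 hlt)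
  refine ⟨e, hsub he, ?_, ?_⟩
  · rintro u ⟨hu, -⟩ v ⟨hv, hve⟩ huv
    rcases huv.eq_or_lt with rfl | huv
    · exact le_rfl
    rcases (mem_Iic.1 hve).eq_or_lt with rfl | hve
    · exact hmin' u hu
    · simpa [hmin' u hu] using hq u hu e (hsub he) v huv hve
  · rintro u ⟨hu, hue⟩ v ⟨hv, -⟩ huv
    rcases huv.eq_or_lt with rfl | huv
    · exact le_rfl
    rcases (mem_Ici.1 hue).eq_or_lt with rfl | hue
    · exact hmin' v hv
    · simpa [hmin' v hv] using hq e (hsub he) v hv u hue huv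

section Averages

variable {f : ℝ → ℝ}

theorem integral_abs_eq_avgAbs (f : ℝ → ℝ) (y : ℝ) {t : ℝ} (ht : 0 < t) :
    ∫ s in (y - t)..(y + t), |f s| = 2 * t * avgAbs f y t := by
  unfold avgAbs
  field_simp

theorem avgAbs_le (hf : Continuous f) {y t C : ℝ} (ht : 0 < t)
    (hC : ∀ s ∈ Icc (y - t) (y + t), |f s| ≤ C) : avgAbs f y t ≤ C := by
  have h := intervalIntegral.integral_mono_on (by linarith : y - t ≤ y + t)
    (hf.abs.intervalIntegrable (μ := volume) _ _) intervalIntegrable_const hC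
  rw [integral_abs_eq_avgAbs f y ht, intervalIntegral.integral_const, smul_eq_mul] at h
  have h2 : 2 * t * avgAbs f y t ≤ 2 * t * C := by linarith
  exact le_of_mul_le_mul_left h2 (by linarith)

theorem continuousOn_avgAbs (hf : Continuous f) :
    ContinuousOn (fun p : ℝ × ℝ => avgAbs f p.1 p.2) {p | 0 < p.2} := by
  have hF : Continuous fun x => ∫ s in (0 : ℝ)..x, |f s| :=
    intervalIntegral.continuous_primitive (fun a b => hf.abs.intervalIntegrable a b) 0
  have hG : Continuous fun p : ℝ × ℝ => ∫ s in (p.1 - p.2)..(p.1 + p.2), |f s| := by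
    have : (fun p : ℝ × ℝ => ∫ s in (p.1 - p.2)..(p.1 + p.2), |f s|) = fun p =>
        (∫ s in (0 : ℝ)..(p.1 + p.2), |f s|) - ∫ s in (0 : ℝ)..(p.1 - p.2), |f s| := by
      funext p
      exact (intervalIntegral.integral_interval_sub_left (hf.abs.intervalIntegrable _ _)
        (hf.abs.intervalIntegrable _ _)).symm
    rw [this]
    exact (hF.comp (by fun_prop : Continuous fun p : ℝ × ℝ => p.1 + p.2)).sub
      (hF.comp (by fun_prop : Continuous fun p : ℝ × ℝ => p.1 - p.2))
  unfold avgAbs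
  refine ContinuousOn.mul (ContinuousOn.div continuousOn_const (by fun_prop) ?_) hG.continuousOn
  rintro p (hp : 0 < p.2)
  positivity

theorem avgAbs_translate_le {K : ℝ≥0} (hf : LipschitzWith K f) (y h : ℝ) {t : ℝ} (ht : 0 < t) :
    avgAbs f y t ≤ avgAbs f (y + h) t + K * |h| := by
  have hc := hf.continuous
  have e : ∫ s in (y + h - t)..(y + h + t), |f s| = ∫ s in (y - t)..(y + t), |f (s + h)| := by
    rw [intervalIntegral.integral_comp_add_right (fun s => |f s|)]
    congr 1 <;> ring
  have hc' : Continuous fun s => |f (s + h)| := by fun_prop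
  have hmono := intervalIntegral.integral_mono_on (μ := volume) (by linarith : y - t ≤ y + t)
    (hc.abs.intervalIntegrable _ _)
    ((hc'.add (continuous_const (y := (K : ℝ) * |h|))).intervalIntegrable _ _)
    (fun s _ => by
      have h1 := hf.dist_le_mul s (s + h)
      rw [Real.dist_eq, Real.dist_eq, show s - (s + h) = -h by ring, abs_neg] at h1
      have h2 := abs_sub_abs_le_abs_sub (f s) (f (s + h))
      change |f s| ≤ |f (s + h)| + K * |h|
      linarith)
  simp only [Pi.add_apply] at hmono
  rw [intervalIntegral.integral_add (hc'.intervalIntegrable _ _) intervalIntegrable_const, ← e,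
    integral_abs_eq_avgAbs f _ ht, integral_abs_eq_avgAbs f _ ht, intervalIntegral.integral_const,
    smul_eq_mul] at hmono
  have h2 : 2 * t * avgAbs f y t ≤ 2 * t * (avgAbs f (y + h) t + K * |h|) := by linarith
  exact le_of_mul_le_mul_left h2 (by linarith)

end Averages

section MaximalFunction

variable {f : ℝ → ℝ} {α B : ℝ}

theorem avgAbs_le_ntMax (hf : Continuous f) (hB : ∀ s, |f s| ≤ B) {x y t : ℝ} (ht : 0 < t)
    (hxy : |x - y| ≤ α * t) : avgAbs f y t ≤ ntMax α f x :=
  le_csSup ⟨B, by rintro _ ⟨y, t, ht, -, rfl⟩; exact avgAbs_le hf ht fun s _ => hB s⟩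
    ⟨y, t, ht, hxy, rfl⟩

theorem ntMax_set_nonempty (hα : 0 ≤ α) (f : ℝ → ℝ) (x : ℝ) :
    {r : ℝ | ∃ y t : ℝ, 0 < t ∧ |x - y| ≤ α * t ∧ r = avgAbs f y t}.Nonempty :=
  ⟨_, x, 1, one_pos, by simpa using hα, rfl⟩

theorem integral_abs_le_ntMax_mul (hf : Continuous f) (hB : ∀ s, |f s| ≤ B) {x p q : ℝ}
    (hpq : p < q) (hx : |x - (p + q) / 2| ≤ α * ((q - p) / 2)) :
    ∫ s in p..q, |f s| ≤ ntMax α f x * (q - p) := by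
  have ht : 0 < (q - p) / 2 := by linarith
  have h := avgAbs_le_ntMax hf hB ht hx
  have e := integral_abs_eq_avgAbs f ((p + q) / 2) ht
  rw [show (p + q) / 2 - (q - p) / 2 = p by ring, show (p + q) / 2 + (q - p) / 2 = q by ring] at e
  rw [e]
  nlinarith

theorem lipschitzWith_ntMax (hα : 0 ≤ α) {K : ℝ≥0} (hf : LipschitzWith K f)
    (hB : ∀ s, |f s| ≤ B) : LipschitzWith K (ntMax α f) := by
  refine LipschitzWith.of_le_add_mul K fun x z => ?_
  refine csSup_le (ntMax_set_nonempty hα f x) ?_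
  rintro _ ⟨y, t, ht, hy, rfl⟩
  have h1 := avgAbs_translate_le hf y (z - x) ht
  have h2 : avgAbs f (y + (z - x)) t ≤ ntMax α f z :=
    avgAbs_le_ntMax hf.continuous hB ht (by convert hy using 2; ring)
  rw [Real.dist_eq, abs_sub_comm]
  linarith

/-- At a point of the detachment set where the maximal function does not attain its infimum,
the supremum defining the maximal function is attained. -/
theorem exists_avgAbs_eq_ntMax (hα : 0 < α) {K : ℝ≥0} (hf : LipschitzWith K f)
    (hB : ∀ s, |f s| ≤ B) {x y : ℝ} (hy : |f y| < ntMax α f y)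
    (hxy : ntMax α f x < ntMax α f y) :
    ∃ c t : ℝ, 0 < t ∧ |y - c| ≤ α * t ∧ avgAbs f c t = ntMax α f y := by
  set M := ntMax α f y
  have hc := hf.continuous
  have small : ∃ δ > 0, ∃ m₁ < M, ∀ c t, 0 < t → t < δ → |y - c| ≤ α * t → avgAbs f c t ≤ m₁ := by
    have hK : (0 : ℝ) ≤ K := K.2
    refine ⟨(M - |f y|) / (2 * ((K + 1) * (α + 1))), by have := sub_pos.2 hy; positivity,
      (|f y| + M) / 2, by linarith, fun c t ht htδ hct => avgAbs_le hc ht fun s hs => ?_⟩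
    rw [lt_div_iff₀ (by positivity)] at htδ
    have h1 := hf.dist_le_mul s y
    rw [Real.dist_eq, Real.dist_eq] at h1
    have h2 := abs_sub_abs_le_abs_sub (f s) (f y)
    have h3 : |s - y| ≤ (α + 1) * t := by
      rw [abs_le] at hct ⊢
      constructor <;> linarith [hs.1, hs.2, hct.1, hct.2]
    have h4 : (K : ℝ) * |s - y| ≤ (K + 1) * ((α + 1) * t) := by
      gcongr
      linarith
    linarith
  have large : ∃ T, ∃ m₂ < M, ∀ c t, 0 < t → T < t → |y - c| ≤ α * t → avgAbs f c t ≤ m₂ := by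
    set N := ntMax α f x
    have hN : 0 ≤ N := by
      refine le_trans ?_ (avgAbs_le_ntMax hc hB one_pos (by simpa using hα.le : |x - x| ≤ α * 1))
      have := intervalIntegral.integral_nonneg (μ := volume) (by linarith : x - 1 ≤ x + 1)
        (fun s _ => abs_nonneg (f s))
      unfold avgAbs
      positivity
    refine ⟨2 * N * (|x - y| / α) / (M - N), (N + M) / 2, by linarith, fun c t ht htT hct => ?_⟩
    rw [div_lt_iff₀ (by linarith)] at htT
    set d := |x - y| / α with hd
    have hd0 : 0 ≤ d := by positivity
    have hdα : α * d = |x - y| := by rw [hd]; field_simp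
    have h1 : avgAbs f c (t + d) ≤ N := avgAbs_le_ntMax hc hB (by linarith) (by
      have := abs_sub_le x y c
      rw [mul_add]
      linarith)
    have h2 : ∫ s in (c - t)..(c + t), |f s| ≤ ∫ s in (c - (t + d))..(c + (t + d)), |f s| :=
      intervalIntegral.integral_mono_interval (by linarith) (by linarith) (by linarith)
        (Eventually.of_forall fun s => abs_nonneg (f s)) (hc.abs.intervalIntegrable _ _)
    rw [integral_abs_eq_avgAbs f c ht, integral_abs_eq_avgAbs f c (by linarith : 0 < t + d)] at h2
    have h3 : 2 * (t + d) * avgAbs f c (t + d) ≤ 2 * (t + d) * N := by gcongr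
    have h4 : 2 * t * avgAbs f c t ≤ 2 * t * ((N + M) / 2) := by linarith
    exact le_of_mul_le_mul_left h4 (by linarith)
  obtain ⟨δ, hδ, m₁, hm₁, h₁⟩ := small
  obtain ⟨T, m₂, hm₂, h₂⟩ := large
  let S : Set (ℝ × ℝ) := {p | |y - p.1| ≤ α * p.2 ∧ δ ≤ p.2 ∧ p.2 ≤ T}
  have hS : IsCompact S := by
    refine (isCompact_Icc (a := ((y - α * T, δ) : ℝ × ℝ)) (b := (y + α * T, T))).of_isClosed_subset
      ?_ ?_
    · have i₁ : IsClosed {p : ℝ × ℝ | |y - p.1| ≤ α * p.2} :=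
        isClosed_le (by fun_prop) (by fun_prop)
      have i₂ : IsClosed {p : ℝ × ℝ | δ ≤ p.2} := isClosed_le (by fun_prop) (by fun_prop)
      have i₃ : IsClosed {p : ℝ × ℝ | p.2 ≤ T} := isClosed_le (by fun_prop) (by fun_prop)
      exact i₁.inter (i₂.inter i₃)
    · rintro ⟨c, t⟩ ⟨h1, h2, h3⟩
      simp only at h1 h2 h3
      have : α * t ≤ α * T := by gcongr
      rw [abs_le] at h1
      exact ⟨⟨by simp only; linarith, h2⟩, ⟨by simp only; linarith, h3⟩⟩
  have key : ∀ c t, 0 < t → |y - c| ≤ α * t → max m₁ m₂ < avgAbs f c t → (c, t) ∈ S := by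
    intro c t ht hct hlt
    refine ⟨hct, ?_, ?_⟩
    · by_contra! h
      exact absurd (h₁ c t ht h hct) (not_le.2 ((le_max_left _ _).trans_lt hlt))
    · by_contra! h
      exact absurd (h₂ c t ht h hct) (not_le.2 ((le_max_right _ _).trans_lt hlt))
  obtain ⟨_, ⟨c₀, t₀, ht₀, hct₀, rfl⟩, hlt₀⟩ :=
    exists_lt_of_lt_csSup (ntMax_set_nonempty hα.le f y) (max_lt hm₁ hm₂)
  obtain ⟨⟨c, t⟩, ⟨hct, hδt, hTt⟩, hmax⟩ := hS.exists_isMaxOn ⟨_, key c₀ t₀ ht₀ hct₀ hlt₀⟩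
    ((continuousOn_avgAbs hc).mono fun p hp => hδ.trans_le hp.2.1)
  simp only at hct hδt
  refine ⟨c, t, by linarith, hct, le_antisymm (avgAbs_le_ntMax hc hB (by linarith) hct) ?_⟩
  refine csSup_le (ntMax_set_nonempty hα.le f y) ?_
  rintro _ ⟨c₁, t₁, ht₁, hct₁, rfl⟩
  by_cases h : max m₁ m₂ < avgAbs f c₁ t₁
  · exact hmax (key c₁ t₁ ht₁ hct₁ h)
  · exact (not_lt.1 h).trans (hlt₀.le.trans (hmax (key c₀ t₀ ht₀ hct₀ hlt₀)))

/-- An average which is the value of the maximal function on the whole set of points seeing it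
cannot strictly exceed `|f|` on that set. -/
theorem false_of_ntMax_eq_of_abs_lt (hα : 1 / 3 < α) (hf : Continuous f) (hB : ∀ s, |f s| ≤ B)
    {c t m : ℝ} (ht : 0 < t) (hm : avgAbs f c t = m)
    (hle : ∀ w, |w - c| ≤ α * t → ntMax α f w ≤ m)
    (hlt : ∀ w, |w - c| ≤ α * t → |f w| < m) : False := by
  have hint := fun a b => hf.abs.intervalIntegrable (μ := volume) a b
  have e := integral_abs_eq_avgAbs f c ht
  rw [hm] at e
  obtain ⟨p, hp0, hp1, hpα, hp3⟩ : ∃ p : ℝ, 0 < p ∧ p < 1 ∧ p ≤ α ∧ p * (1 + α) ≤ 3 * α - 1 := by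
    refine ⟨(3 * α - 1) / (3 * (1 + α)), div_pos (by linarith) (by linarith), ?_, ?_, ?_⟩
    · rw [div_lt_one (by linarith)]; linarith
    · rw [div_le_iff₀ (by linarith)]; nlinarith
    · rw [div_mul_eq_mul_div, div_le_iff₀ (by linarith)]; nlinarith
  have hpt : 0 < p * t := by positivity
  have hpt1 : p * t < t := by nlinarith
  have left : ∫ s in (c - t)..c, |f s| ≤ m * t := by
    obtain ⟨w, hw1, hw2⟩ : ∃ w, |w - c| ≤ α * t ∧
        |w - (c - t + c) / 2| ≤ α * ((c - (c - t)) / 2) := by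
      rcases le_total (1 / 2) α with h | h
      · refine ⟨c - t / 2, ?_, ?_⟩ <;> rw [abs_le] <;> constructor <;> nlinarith
      · refine ⟨c - α * t, ?_, ?_⟩ <;> rw [abs_le] <;> constructor <;> nlinarith
    have := integral_abs_le_ntMax_mul hf hB (by linarith : c - t < c) hw2
    have := hle w hw1
    nlinarith
  have right : ∫ s in (c + p * t)..(c + t), |f s| ≤ m * (t - p * t) := by
    obtain ⟨w, hw1, hw2⟩ : ∃ w, |w - c| ≤ α * t ∧
        |w - (c + p * t + (c + t)) / 2| ≤ α * ((c + t - (c + p * t)) / 2) := by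
      have hpt3 : p * (1 + α) * t ≤ (3 * α - 1) * t := by gcongr
      rcases le_total ((1 + p) / 2) α with h | h
      · refine ⟨c + (1 + p) / 2 * t, ?_, ?_⟩ <;> rw [abs_le] <;> constructor <;> nlinarith
      · refine ⟨c + α * t, ?_, ?_⟩ <;> rw [abs_le] <;> constructor <;> nlinarith
    have := integral_abs_le_ntMax_mul hf hB (by linarith : c + p * t < c + t) hw2
    have := hle w hw1
    nlinarith
  have middle : ∫ s in c..(c + p * t), |f s| < m * (p * t) := by
    have hin : ∀ s ∈ Icc c (c + p * t), |f s| < m := fun s hs => hlt s (by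
      have : p * t ≤ α * t := by gcongr
      rw [abs_le]
      constructor <;> linarith [hs.1, hs.2])
    have h := intervalIntegral.integral_lt_integral_of_continuousOn_of_le_of_exists_lt
      (by linarith : c < c + p * t) hf.abs.continuousOn (continuousOn_const (c := m))
      (fun s hs => (hin s (Ioc_subset_Icc_self hs)).le)
      ⟨c, left_mem_Icc.2 (by linarith), hin c (left_mem_Icc.2 (by linarith))⟩
    rw [intervalIntegral.integral_const, smul_eq_mul] at h
    linarith
  have s1 := intervalIntegral.integral_add_adjacent_intervals (hint (c - t) c) (hint c (c + p * t))
  have s2 := intervalIntegral.integral_add_adjacent_intervals (hint (c - t) (c + p * t))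
    (hint (c + p * t) (c + t))
  linarith

/-- On an interval where it exceeds `|f|`, the maximal function is quasiconvex. -/
theorem ntMax_le_max (hα : 1 / 3 < α) {K : ℝ≥0} (hf : LipschitzWith K f) (hB : ∀ s, |f s| ≤ B)
    {a b z : ℝ} (hab : a < b) (hbz : b < z) (hE : ∀ w ∈ Icc a z, |f w| < ntMax α f w) :
    ntMax α f b ≤ max (ntMax α f a) (ntMax α f z) := by
  by_contra! hlt
  obtain ⟨ha, hz⟩ := max_lt_iff.1 hlt
  obtain ⟨y, hy, hmax⟩ := isCompact_Icc.exists_isMaxOn (nonempty_Icc.2 (hab.trans hbz).le)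
    (lipschitzWith_ntMax (α := α) (by linarith) hf hB).continuous.continuousOn
  have hb : ntMax α f b ≤ ntMax α f y := hmax ⟨hab.le, hbz.le⟩
  obtain ⟨c, t, ht, hct, he⟩ :=
    exists_avgAbs_eq_ntMax (by linarith) hf hB (hE y hy) (ha.trans_le hb)
  have hge : ∀ w, |w - c| ≤ α * t → ntMax α f y ≤ ntMax α f w := fun w hw =>
    he.symm.le.trans (avgAbs_le_ntMax hf.continuous hB ht hw)
  have hmem : ∀ w, |w - c| ≤ α * t → w ∈ Icc a z := by
    intro w hw
    rw [abs_le] at hw hct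
    constructor
    · by_contra! h
      have := hge a (abs_le.2 ⟨by linarith [hw.1], by linarith [hy.1, hct.2]⟩)
      linarith
    · by_contra! h
      have := hge z (abs_le.2 ⟨by linarith [hy.2, hct.1], by linarith [hw.2]⟩)
      linarith
  have hle : ∀ w, |w - c| ≤ α * t → ntMax α f w ≤ ntMax α f y := fun w hw => hmax (hmem w hw)
  exact false_of_ntMax_eq_of_abs_lt hα hf.continuous hB ht he hle fun w hw =>
    (hE w (hmem w hw)).trans_le (hle w hw)

end MaximalFunction

/-- Let `α > 1/3` and let `f` be nonnegative, Lipschitz and of bounded variation. On every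
connected component `I` of the detachment set `E_α = {x : M^α f(x) > f(x)}`, the maximal
function `M^α f` is either monotone or V-shaped: there is `c ∈ I` with `M^α f` non-increasing
on the part of `I` to the left of `c` and non-decreasing on the part to the right. -/
theorem ntMax_monotone_or_Vshaped_on_components (α : ℝ) (hα : (1 / 3 : ℝ) < α)
    (f : ℝ → ℝ) (hf0 : ∀ x, 0 ≤ f x) (hLip : ∃ K : ℝ≥0, LipschitzWith K f)
    (hBV : BoundedVariationOn f Set.univ)
    (x : ℝ) (hx : x ∈ {z : ℝ | f z < ntMax α f z}) :
    (MonotoneOn (ntMax α f) (connectedComponentIn {z : ℝ | f z < ntMax α f z} x) ∨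
      AntitoneOn (ntMax α f) (connectedComponentIn {z : ℝ | f z < ntMax α f z} x)) ∨
    ∃ c ∈ connectedComponentIn {z : ℝ | f z < ntMax α f z} x,
      AntitoneOn (ntMax α f)
        (connectedComponentIn {z : ℝ | f z < ntMax α f z} x ∩ Set.Iic c) ∧
      MonotoneOn (ntMax α f)
        (connectedComponentIn {z : ℝ | f z < ntMax α f z} x ∩ Set.Ici c) := by
  obtain ⟨K, hK⟩ := hLip
  have hB : ∀ s, |f s| ≤ f 0 + (eVariationOn f univ).toReal := fun s => by
    have := hBV.sub_le (mem_univ s) (mem_univ 0)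
    rw [abs_of_nonneg (hf0 s)]
    linarith
  have hI : (connectedComponentIn {z : ℝ | f z < ntMax α f z} x).OrdConnected :=
    isPreconnected_connectedComponentIn.ordConnected
  refine monotoneOn_or_antitoneOn_or_vShaped hI
    (lipschitzWith_ntMax (by linarith) hK hB).continuous.continuousOn ?_
  intro a ha z hz b hab hbz
  refine ntMax_le_max hα hK hB hab hbz fun w hw => ?_
  rw [abs_of_nonneg (hf0 w)]
  exact (connectedComponentIn_subset _ _ (hI.out ha hz hw) :
    w ∈ {z : ℝ | f z < ntMax α f z})
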